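/- Let 1 ≤ m ≤ a+1 and let t, i, s_2,…,s_m be integers with s_j ≥ 0 for all j, t + Σ_{j=2}^m s_j = a+1−m, and 0 < ia < tb. Then the divisors (tb−ia)P_1 + Σ_{j=2}^m (s_jb + i)P_j and Σ_{j=m+1}^{a+1} (b−i)P_j are linearly equivalent; in particular there exists a rational function on 𝒳 whose pole divisor is exactly (tb−ia)P_1 + Σ_{j=2}^m (s_jb + i)P_j. -/

import Mathlib

open scoped Classical

/-- Abstract data of a nonsingular, projective, geometrically irreducible algebraic curve
over a field `Fq`, recorded through its function field `K`: a type of rational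
(degree-one) points together with the normalized discrete valuation `v P` at each point
`P`.  For a nonzero rational function `f`, `v P f` is the order of vanishing of `f`
at `P` (negative at poles), it is multiplicative-to-additive, vanishes on the nonzero
constants, attains the value `1` (uniformizers exist) and every nonzero function has
only finitely many zeros and poles. -/
structure CurveData (Fq K : Type) [Field Fq] [Field K] [Algebra Fq K] : Type 1 where
  /-- The rational (degree-one) points of the curve. -/
  Point : Type
  /-- The normalized discrete valuation at each point. -/
  v : Point → K → ℤ
  v_mul : ∀ P (f g : K), f ≠ 0 → g ≠ 0 → v P (f * g) = v P f + v P g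
  v_const : ∀ P (c : Fq), c ≠ 0 → v P (algebraMap Fq K c) = 0
  v_surj : ∀ P, ∃ f : K, f ≠ 0 ∧ v P f = 1
  finite_supp : ∀ f : K, f ≠ 0 → {P | v P f ≠ 0}.Finite

namespace CurveData

variable {Fq K : Type} [Field Fq] [Field K] [Algebra Fq K] (C : CurveData Fq K)

/-- The divisor `n 0 • P 0 + ⋯ + n (m-1) • P (m-1)`, as a `ℤ`-valued function on
the points of the curve. -/
noncomputable def comb {m : ℕ} (P : Fin m → C.Point) (n : Fin m → ℤ) : C.Point → ℤ :=
  fun Q => ∑ i, if Q = P i then n i else 0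

/-- The divisor consisting of the single point `P` (with coefficient one). -/
noncomputable def single (P : C.Point) : C.Point → ℤ :=
  fun Q => if Q = P then 1 else 0

/-- `f` is a nonzero rational function whose pole divisor is exactly `D`, i.e.
`(f)_∞ = D`:  at every point `Q` the pole order `max 0 (-(v Q f))` equals `D Q`. -/
def IsPoleDiv (f : K) (D : C.Point → ℤ) : Prop :=
  f ≠ 0 ∧ ∀ Q, max 0 (-(C.v Q f)) = D Q

/-- The Weierstrass semigroup `H(P 0, …, P (m-1))`: the set of `(a 0, …, a (m-1))`
in `ℕ₀^m` such that some rational function has pole divisor `∑ i, a i • P i`. -/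
def WSgp {m : ℕ} (P : Fin m → C.Point) : Set (Fin m → ℕ) :=
  { a | ∃ f : K, C.IsPoleDiv f (C.comb P fun i => (a i : ℤ)) }

/-- The set `∇ᵢ(n)` of elements of the Weierstrass semigroup whose `i`-th coordinate
equals `n i`. -/
def nabla {m : ℕ} (P : Fin m → C.Point) (i : Fin m) (n : Fin m → ℕ) : Set (Fin m → ℕ) :=
  { p ∈ C.WSgp P | p i = n i }

/-- The minimal generating set `Γ(P 0, …, P (m-1))`: the vectors `n ∈ ℕ^m` (all
coordinates positive) that are minimal, with respect to the coordinatewise partial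
order, in `∇ᵢ(n)` for some `i`. -/
def Gamma {m : ℕ} (P : Fin m → C.Point) : Set (Fin m → ℕ) :=
  { n | (∀ i, 0 < n i) ∧ ∃ i, Minimal (· ∈ C.nabla P i n) n }

/-- The Riemann–Roch space `L(A) = {f ∈ K* : (f) + A ≥ 0} ∪ {0}`. -/
def RR (A : C.Point → ℤ) : Set K :=
  { f | f = 0 ∨ ∀ P, 0 ≤ C.v P f + A P }

/-- The divisor `A` is a discrepancy for the rational points `P` and `Q`:
`L(A) ≠ L(A-P) = L(A-P-Q)` and `L(A) ≠ L(A-Q) = L(A-P-Q)`. -/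
def IsDiscrepancy (A : C.Point → ℤ) (P Q : C.Point) : Prop :=
  (C.RR A ≠ C.RR (A - C.single P)
      ∧ C.RR (A - C.single P) = C.RR (A - C.single P - C.single Q))
    ∧ (C.RR A ≠ C.RR (A - C.single Q)
      ∧ C.RR (A - C.single Q) = C.RR (A - C.single P - C.single Q))

/-- Linear equivalence of divisors: `D ~ D'` iff `D - D'` is the divisor of a
nonzero rational function. -/
def LinEquiv (D D' : C.Point → ℤ) : Prop :=
  ∃ f : K, f ≠ 0 ∧ ∀ P, C.v P f = D P - D' P

/-- The group of principal divisors. -/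
def principal : AddSubgroup (C.Point → ℤ) where
  carrier := {D | ∃ f : K, f ≠ 0 ∧ ∀ P, C.v P f = D P}
  zero_mem' := ⟨1, one_ne_zero, fun P => by
    have h := C.v_mul P 1 1 one_ne_zero one_ne_zero
    rw [mul_one] at h
    simpa using h⟩
  add_mem' := by
    rintro D E ⟨f, hf, hfD⟩ ⟨g, hg, hgE⟩
    exact ⟨f * g, mul_ne_zero hf hg, fun P => by simp [C.v_mul P f g hf hg, hfD, hgE]⟩
  neg_mem' := by
    rintro D ⟨f, hf, hfD⟩
    refine ⟨f⁻¹, inv_ne_zero hf, fun P => ?_⟩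
    have h := C.v_mul P 1 1 one_ne_zero one_ne_zero
    have h' := C.v_mul P f f⁻¹ hf (inv_ne_zero hf)
    rw [mul_one] at h
    rw [mul_inv_cancel₀ hf, hfD] at h'
    rw [Pi.neg_apply]
    omega

theorem linEquiv_iff_sub_mem_principal {D E : C.Point → ℤ} :
    C.LinEquiv D E ↔ D - E ∈ C.principal :=
  Iff.rfl

theorem comb_apply_of_injective {m : ℕ} {P : Fin m → C.Point} (hP : Function.Injective P)
    (n : Fin m → ℤ) (j : Fin m) : C.comb P n (P j) = n j := by
  simp [comb, hP.eq_iff]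

theorem comb_apply_of_notMem_range {m : ℕ} {P : Fin m → C.Point} (n : Fin m → ℤ)
    {Q : C.Point} (hQ : Q ∉ Set.range P) : C.comb P n Q = 0 :=
  Finset.sum_eq_zero fun j _ => if_neg fun h => hQ ⟨j, h.symm⟩

/-- If `D ~ E` with `D` and `E` effective with disjoint supports, then `D` is a pole divisor. -/
theorem LinEquiv.exists_isPoleDiv {D E : C.Point → ℤ} (h : C.LinEquiv D E)
    (hDE : ∀ Q, max 0 (D Q - E Q) = D Q) : ∃ f : K, C.IsPoleDiv f D := by
  obtain ⟨f, hf, hfv⟩ := C.principal.neg_mem (C.linEquiv_iff_sub_mem_principal.1 h)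
  exact ⟨f, hf, fun Q => by simpa [hfv] using hDE Q⟩

end CurveData

/-- divisor equivalence (4) of the paper.  For `1 ≤ m ≤ a+1` and
integers `t, i, s₂, …, s_m` with `s_j ≥ 0`, `t + ∑ s_j = a+1-m` and `0 < ia < tb`,
the divisors `(tb-ia)P₁ + ∑_{j=2}^m (s_j b + i)P_j` and `∑_{j=m+1}^{a+1} (b-i)P_j`
are linearly equivalent; in particular some rational function has pole divisor
exactly `(tb-ia)P₁ + ∑_{j=2}^m (s_j b + i)P_j`. -/
theorem divisor_equivalence_and_pole_divisor
    {Fq K : Type} [Field Fq] [Fintype Fq] [Field K] [Algebra Fq K]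
    (C : CurveData Fq K) (a b : ℕ) (ha : 2 ≤ a) (hb : 2 ≤ b)
    (hab : Nat.Coprime a b)
    -- the plane model `f(y) = g(x)` with `deg f = a`, `deg g = b`,
    -- where `x` and `y` generate the function field `K` over `Fq`
    (fpol gpol : Polynomial Fq) (x y : K)
    (hdegf : fpol.natDegree = a) (hdegg : gpol.natDegree = b)
    (hmodel : Polynomial.aeval y fpol = Polynomial.aeval x gpol)
    (hgen : IntermediateField.adjoin Fq {x, y} = ⊤)
    -- the distinct rational points `P 0 = P₁, …, P a = P_{a+1}`
    (P : Fin (a + 1) → C.Point) (hP : Function.Injective P)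
    -- the genus of the curve is `(a-1)(b-1)/2`, expressed through the number of
    -- gaps at the rational point `P 0`
    (hgenus : {n : ℕ | (fun _ : Fin 1 => n) ∉ C.WSgp (fun _ : Fin 1 => P 0)}.encard
        = (((a - 1) * (b - 1) / 2 : ℕ) : ℕ∞))
    -- (1)  `a P₁ ~ P₂ + ⋯ + P_{a+1}`
    (h1 : C.LinEquiv (C.comb P fun j => if j = 0 then (a : ℤ) else 0)
        (C.comb P fun j => if j = 0 then 0 else 1))
    -- (2)  `b P_i ~ b P_j` for all `i, j ∈ {1, …, a+1}`
    (h2 : ∀ i j : Fin (a + 1),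
        C.LinEquiv (C.comb P fun k => if k = i then (b : ℤ) else 0)
          (C.comb P fun k => if k = j then (b : ℤ) else 0))
    (m : ℕ) (hm1 : 1 ≤ m) (hma : m ≤ a + 1)
    (t i : ℤ) (s : ℕ → ℤ) (hs : ∀ k ∈ Finset.Ico 1 m, 0 ≤ s k)
    (hsum : t + ∑ k ∈ Finset.Ico 1 m, s k = (a : ℤ) + 1 - m)
    (hia : 0 < i * a) (htb : i * a < t * b) :
    C.LinEquiv
        (C.comb P fun j => if (j : ℕ) = 0 then t * b - i * a
          else if (j : ℕ) < m then s (j : ℕ) * b + i else 0)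
        (C.comb P fun j => if (j : ℕ) < m then 0 else (b : ℤ) - i)
      ∧ ∃ f : K, C.IsPoleDiv f
        (C.comb P fun j => if (j : ℕ) = 0 then t * b - i * a
          else if (j : ℕ) < m then s (j : ℕ) * b + i else 0) := by
  have hi : 0 < i := pos_of_mul_pos_left hia (by positivity)
  have hs_nonneg := Finset.sum_nonneg hs
  have hib : i < b := by
    have hta : t ≤ a := by omega
    have : t * b ≤ a * b := mul_le_mul_of_nonneg_right hta (by positivity)
    refine lt_of_mul_lt_mul_right (a := (a : ℤ)) ?_ (by positivity)
    linarith
  set c : ℕ → ℤ := fun k => if k = 0 then 0 else if k < m then s k else -1 with hc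
  have hcsum : ∑ j : Fin (a + 1), c j = -t := by
    rw [Fin.sum_univ_eq_sum_range c, Finset.range_eq_Ico,
      ← Finset.sum_Ico_consecutive c (Nat.zero_le m) hma,
      Finset.sum_eq_sum_Ico_succ_bot (by omega : 0 < m)]
    have hlow : ∑ k ∈ Finset.Ico (0 + 1) m, c k = ∑ k ∈ Finset.Ico 1 m, s k := by
      refine Finset.sum_congr rfl fun k hk => ?_
      rw [Finset.mem_Ico] at hk
      simp only [hc]
      rw [if_neg (by omega), if_pos hk.2]
    have hhigh : ∑ k ∈ Finset.Ico m (a + 1), c k = ∑ k ∈ Finset.Ico m (a + 1), (-1 : ℤ) := by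
      refine Finset.sum_congr rfl fun k hk => ?_
      rw [Finset.mem_Ico] at hk
      simp only [hc]
      rw [if_neg (by omega), if_neg (by omega)]
    rw [hlow, hhigh]
    simp [hc, Nat.cast_sub hma]
    linarith
  have hlin : C.LinEquiv
      (C.comb P fun j => if (j : ℕ) = 0 then t * b - i * a
        else if (j : ℕ) < m then s (j : ℕ) * b + i else 0)
      (C.comb P fun j => if (j : ℕ) < m then 0 else (b : ℤ) - i) := by
    rw [C.linEquiv_iff_sub_mem_principal]
    have hmem := C.principal.add_mem
      (C.principal.zsmul_mem (C.linEquiv_iff_sub_mem_principal.1 h1) (-i))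
      (C.principal.sum_mem fun (j : Fin (a + 1)) (_ : j ∈ Finset.univ) =>
        C.principal.zsmul_mem (C.linEquiv_iff_sub_mem_principal.1 (h2 j 0)) (c j))
    convert hmem using 1
    funext Q
    by_cases hQ : Q ∈ Set.range P
    · obtain ⟨k, rfl⟩ := hQ
      simp only [Pi.add_apply, Pi.sub_apply, Pi.smul_apply, Finset.sum_apply,
        C.comb_apply_of_injective hP, smul_eq_mul, mul_sub, Finset.sum_sub_distrib,
        mul_ite, mul_zero, Finset.sum_ite_eq, Finset.mem_univ, if_true]
      by_cases hk : k = 0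
      · subst hk
        have hc0 : c 0 = 0 := if_pos rfl
        simp [hc0, ← Finset.sum_mul, hcsum, Nat.pos_of_ne_zero (by omega : m ≠ 0)]
        ring
      · by_cases hkm : (k : ℕ) < m <;> simp [hc, hk, hkm] <;> ring
    · simp [C.comb_apply_of_notMem_range _ hQ]
  refine ⟨hlin, CurveData.LinEquiv.exists_isPoleDiv C hlin fun Q => ?_⟩
  by_cases hQ : Q ∈ Set.range P
  · obtain ⟨k, rfl⟩ := hQ
    rw [C.comb_apply_of_injective hP, C.comb_apply_of_injective hP]
    by_cases hk : (k : ℕ) = 0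
    · rw [if_pos hk, if_pos (by omega), sub_zero, max_eq_right (by linarith)]
    · by_cases hkm : (k : ℕ) < m
      · have := mul_nonneg (hs k (Finset.mem_Ico.2 ⟨by omega, hkm⟩)) (Nat.cast_nonneg (α := ℤ) b)
        rw [if_neg hk, if_pos hkm, if_pos hkm, sub_zero, max_eq_right (by linarith)]
      · rw [if_neg hk, if_neg hkm, if_neg hkm, max_eq_left (by linarith)]
  · simp [C.comb_apply_of_notMem_range _ hQ]
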